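/- arXiv:2311.17385 — 2 statements merged into one kernel-verified Lean document; each statement's English description precedes it below -/
import Mathlib

section
/- In the polynomial ring k[y1,y2] over a field k of characteristic 0, the two polynomials z2 = y1² + y2² + y1·y2 and z3 = 2y1³ + 3y1²y2 − 3y1y2² − 2y2³ are algebraically independent over k. -/
open MvPolynomial

/-- If `y ≠ 0` is killed by an algebra homomorphism that sends `x` to a transcendental element,
then `x` and `y` are algebraically independent. -/
theorem Transcendental.algebraicIndependent_pair_of_algHom {R A B : Type*} [CommRing R]
    [CommRing A] [IsDomain A] [CommRing B] [Algebra R A] [Algebra R B] {x y : A} (φ : A →ₐ[R] B)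
    (hx : Transcendental R (φ x)) (hφy : φ y = 0) (hy : y ≠ 0) :
    AlgebraicIndependent R ![x, y] := by
  have hxA : Transcendental R x := fun h ↦ hx (h.algHom φ)
  rw [AlgebraicIndependent.iff_transcendental_adjoin_image 1]
  have : Unique {j : Fin 2 // j ≠ 1} :=
    { default := ⟨0, by decide⟩
      uniq := by decide }
  refine ⟨?_, ?_⟩
  · rw [algebraicIndependent_singleton_iff ⟨0, by decide⟩]
    exact hxA
  · have him : (![x, y] '' {1}ᶜ) = {x} := by
      ext z
      simp [Fin.exists_fin_two, eq_comm]
    rw [him]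
    intro hy'
    obtain ⟨q, hq0, hq⟩ :=
      hy'.exists_nonzero_coeff_and_aeval_eq_zero (mem_nonZeroDivisors_of_ne_zero hy)
    obtain ⟨p, hp⟩ := (Algebra.adjoin_singleton_eq_range_aeval R x).le (q.coeff 0).2
    replace hp : Polynomial.aeval x p = (q.coeff 0 : A) := hp
    have h0 : φ (q.coeff 0 : A) = 0 := by
      have := congrArg φ hq
      rw [← Polynomial.divX_mul_X_add q] at this
      simpa [hφy] using this
    rw [← hp, ← Polynomial.aeval_algHom_apply] at h0
    rw [transcendental_iff.mp hx p h0, map_zero] at hp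
    exact hq0 (Subtype.ext hp.symm)

/-- `z₂ = y₁² + y₂² + y₁y₂` and `z₃ = 2y₁³ + 3y₁²y₂ − 3y₁y₂² − 2y₂³` are algebraically
independent over a field of characteristic zero. -/
theorem stmt_1 {k : Type*} [Field k] [CharZero k] :
    AlgebraicIndependent k
      ![(X 0 ^ 2 + X 1 ^ 2 + X 0 * X 1 : MvPolynomial (Fin 2) k),
        (2 * X 0 ^ 3 + 3 * X 0 ^ 2 * X 1 - 3 * X 0 * X 1 ^ 2 - 2 * X 1 ^ 3 :
          MvPolynomial (Fin 2) k)] := by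
  refine Transcendental.algebraicIndependent_pair_of_algHom
    (aeval fun _ ↦ (Polynomial.X : Polynomial k)) ?_ ?_ ?_
  · have h : (Polynomial.X ^ 2 + Polynomial.X ^ 2 + Polynomial.X * Polynomial.X : Polynomial k) =
        Polynomial.C 3 * Polynomial.X ^ 2 := by
      simp only [map_ofNat]
      ring
    simp only [map_add, map_mul, map_pow, aeval_X, h]
    have h3 : (3 : k) ≠ 0 := three_ne_zero
    refine Polynomial.transcendental _ ?_ ?_
    · rw [Polynomial.natDegree_C_mul_X_pow 2 3 h3]
      exact two_ne_zero
    · rw [Polynomial.leadingCoeff_C_mul_X_pow]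
      exact mem_nonZeroDivisors_of_ne_zero h3
  · simp
    ring
  · intro h
    simpa using congrArg (eval ![1, 0]) h
end

section
/- Equip P = k[x1,x2] (viewed inside k[x1,x2,x3]) with the Poisson bracket with {x1,x2} = 0, {x2,x3} = 2x1x2 + x2², {x3,x1} = x1² + 2x1x2 (superpotential Ω = x1²x2 + x1x2²). Let w1 = (1/3)(a+b)x1 + (1/3)(2a−b)x2 + x3, w2 = x1² + x2² + x1x2, w3 = 2x1³ + 3x1²x2 − 3x1x2² − 2x2³ for fixed a, b ∈ k. Then {w1, w2} = w3, {w2, w3} = 0, and {w3, w1} = −6 w2². -/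
open MvPolynomial

/-- The Jacobian Poisson bracket `{f,g} = det Jac(f,g,Ω)` on `k[x₁,x₂,x₃]`. -/
noncomputable def jacBracket {k : Type*} [Field k] (Ω f g : MvPolynomial (Fin 3) k) :
    MvPolynomial (Fin 3) k :=
  pderiv 0 f * (pderiv 1 g * pderiv 2 Ω - pderiv 2 g * pderiv 1 Ω)
  + pderiv 1 f * (pderiv 2 g * pderiv 0 Ω - pderiv 0 g * pderiv 2 Ω)
  + pderiv 2 f * (pderiv 0 g * pderiv 1 Ω - pderiv 1 g * pderiv 0 Ω)

/-- For the bracket with superpotential `Ω = x₁²x₂ + x₁x₂²` and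
`w₁ = (1/3)(a+b)x₁ + (1/3)(2a−b)x₂ + x₃`, `w₂ = x₁² + x₂² + x₁x₂`,
`w₃ = 2x₁³ + 3x₁²x₂ − 3x₁x₂² − 2x₂³`, one has
`{w₁,w₂} = w₃`, `{w₂,w₃} = 0`, `{w₃,w₁} = −6w₂²`. -/
theorem stmt_11 {k : Type*} [Field k] [CharZero k] (a b : k) :
    letI Ω : MvPolynomial (Fin 3) k := X 0 ^ 2 * X 1 + X 0 * X 1 ^ 2
    letI w1 : MvPolynomial (Fin 3) k :=
      C ((a + b)/3) * X 0 + C ((2*a - b)/3) * X 1 + X 2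
    letI w2 : MvPolynomial (Fin 3) k := X 0 ^ 2 + X 1 ^ 2 + X 0 * X 1
    letI w3 : MvPolynomial (Fin 3) k :=
      2 * X 0 ^ 3 + 3 * X 0 ^ 2 * X 1 - 3 * X 0 * X 1 ^ 2 - 2 * X 1 ^ 3
    jacBracket Ω w1 w2 = w3 ∧ jacBracket Ω w2 w3 = 0 ∧
      jacBracket Ω w3 w1 = -6 * w2 ^ 2 := by
  have h2 (i : Fin 3) : pderiv i (2 : MvPolynomial (Fin 3) k) = 0 := by
    exact_mod_cast (pderiv i).map_natCast 2
  have h3 (i : Fin 3) : pderiv i (3 : MvPolynomial (Fin 3) k) = 0 := by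
    exact_mod_cast (pderiv i).map_natCast 3
  refine ⟨?_, ?_, ?_⟩
  · simp [jacBracket, Derivation.leibniz, Derivation.leibniz_pow, pderiv_X]
    ring
  · simp [jacBracket, pderiv_X, h2, h3]
  · simp [jacBracket, Derivation.leibniz, Derivation.leibniz_pow, pderiv_X, h2, h3]
    ring
end
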